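/- arXiv:2101.11304 — 2 statements merged into one kernel-verified Lean document; each statement's English description precedes it below -/
import Mathlib

section
/- Let n ≥ 5 be an integer and let v₁, v₂ : ℝ → (0,∞) be C⁴ periodic solutions of the Delaunay ODE v'''' − ((n(n−4)+8)/2) v'' + (n²(n−4)²/16) v = (n(n−4)(n²−4)/16) v^{(n+4)/(n−4)}. If the (constant) values of their reduced Hamiltonians agree, H̄(v₁) = H̄(v₂), then v₂ is a time translate of v₁: there exists T ∈ ℝ with v₂(t) = v₁(t+T) for all t ∈ ℝ. -/
/-- The reduced Hamiltonian
`H̄(v)(t) = −v'(t)v'''(t) + (1/2)(v''(t))² + ((n(n−4)+8)/4)(v'(t))²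
  − (n²(n−4)²/32) v(t)² + ((n−4)²(n²−4)/32) v(t)^{2n/(n−4)}`. -/
noncomputable def redHam (n : ℕ) (v : ℝ → ℝ) (t : ℝ) : ℝ :=
  -(deriv v t) * iteratedDeriv 3 v t + (1/2) * (iteratedDeriv 2 v t)^2
    + (((n : ℝ) * ((n : ℝ) - 4) + 8)/4) * (deriv v t)^2
    - ((n : ℝ)^2 * ((n : ℝ) - 4)^2/32) * (v t)^2
    + (((n : ℝ) - 4)^2 * ((n : ℝ)^2 - 4)/32) * v t ^ ((2 * (n : ℝ))/((n : ℝ) - 4))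

/-- The Delaunay ODE
`v'''' − ((n(n−4)+8)/2) v'' + (n²(n−4)²/16) v = (n(n−4)(n²−4)/16) v^{(n+4)/(n−4)}` at `t`. -/
def DelaunayODE (n : ℕ) (v : ℝ → ℝ) (t : ℝ) : Prop :=
  iteratedDeriv 4 v t - (((n : ℝ) * ((n : ℝ) - 4) + 8)/2) * iteratedDeriv 2 v t
      + ((n : ℝ)^2 * ((n : ℝ) - 4)^2/16) * v t
    = ((n : ℝ) * ((n : ℝ) - 4) * ((n : ℝ)^2 - 4)/16) * v t ^ (((n : ℝ) + 4)/((n : ℝ) - 4))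

open Set Filter Topology

namespace Delaunay

/-- Strict positivity of four functions propagates forward in time as long as nonnegativity of all
of them makes them all nondecreasing. -/
lemma pos_of_deriv_nonneg {y₁ y₂ y₃ y₄ z₁ z₂ z₃ z₄ : ℝ → ℝ}
    (h₁ : ∀ t, HasDerivAt y₁ (z₁ t) t) (h₂ : ∀ t, HasDerivAt y₂ (z₂ t) t)
    (h₃ : ∀ t, HasDerivAt y₃ (z₃ t) t) (h₄ : ∀ t, HasDerivAt y₄ (z₄ t) t)
    (hz : ∀ t, 0 ≤ y₁ t → 0 ≤ y₂ t → 0 ≤ y₃ t → 0 ≤ y₄ t →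
      0 ≤ z₁ t ∧ 0 ≤ z₂ t ∧ 0 ≤ z₃ t ∧ 0 ≤ z₄ t)
    (i₁ : 0 < y₁ 0) (i₂ : 0 < y₂ 0) (i₃ : 0 < y₃ 0) (i₄ : 0 < y₄ 0) {t : ℝ} (ht : 0 ≤ t) :
    0 < y₁ t ∧ 0 < y₂ t ∧ 0 < y₃ t ∧ 0 < y₄ t := by
  have c₁ : Continuous y₁ := continuous_iff_continuousAt.2 fun t => (h₁ t).continuousAt
  have c₂ : Continuous y₂ := continuous_iff_continuousAt.2 fun t => (h₂ t).continuousAt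
  have c₃ : Continuous y₃ := continuous_iff_continuousAt.2 fun t => (h₃ t).continuousAt
  have c₄ : Continuous y₄ := continuous_iff_continuousAt.2 fun t => (h₄ t).continuousAt
  set m : ℝ → ℝ := fun t => min (min (y₁ t) (y₂ t)) (min (y₃ t) (y₄ t)) with hm
  have cm : Continuous m := by fun_prop
  have hmpos : ∀ t, 0 < m t ↔ (0 < y₁ t ∧ 0 < y₂ t ∧ 0 < y₃ t ∧ 0 < y₄ t) := by
    intro t; simp [hm, and_assoc]
  rw [← hmpos]
  by_contra hneg
  rw [not_lt] at hneg
  have hcpt : IsCompact (Icc 0 t ∩ {x | m x ≤ 0}) :=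
    isCompact_Icc.inter_right (isClosed_le cm continuous_const)
  obtain ⟨s, ⟨⟨hs0, hst⟩, hs⟩, hleast⟩ := hcpt.exists_isLeast ⟨t, ⟨ht, le_rfl⟩, hneg⟩
  have hbefore : ∀ x ∈ Ioo 0 s, 0 < y₁ x ∧ 0 < y₂ x ∧ 0 < y₃ x ∧ 0 < y₄ x := by
    intro x hx
    rw [← hmpos]
    by_contra hx'
    exact absurd (hleast ⟨⟨hx.1.le, hx.2.le.trans hst⟩, not_lt.1 hx'⟩) (not_le.2 hx.2)
  have hzs : ∀ x ∈ Ioo 0 s, 0 ≤ z₁ x ∧ 0 ≤ z₂ x ∧ 0 ≤ z₃ x ∧ 0 ≤ z₄ x := fun x hx =>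
    have := hbefore x hx
    hz x this.1.le this.2.1.le this.2.2.1.le this.2.2.2.le
  have mono : ∀ y z : ℝ → ℝ, (∀ t, HasDerivAt y (z t) t) → (∀ x ∈ Ioo 0 s, 0 ≤ z x) →
      0 < y 0 → 0 < y s := by
    intro y z hy hz' h0
    have : MonotoneOn y (Icc 0 s) := by
      refine monotoneOn_of_deriv_nonneg (convex_Icc _ _)
        (fun x _ => (hy x).continuousAt.continuousWithinAt)
        (fun x _ => (hy x).differentiableAt.differentiableWithinAt) ?_
      intro x hx
      rw [interior_Icc] at hx
      rw [(hy x).deriv]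
      exact hz' x hx
    exact h0.trans_le (this ⟨le_rfl, hs0⟩ ⟨hs0, le_rfl⟩ hs0)
  have : 0 < m s := (hmpos s).2
    ⟨mono _ _ h₁ (fun x hx => (hzs x hx).1) i₁, mono _ _ h₂ (fun x hx => (hzs x hx).2.1) i₂,
      mono _ _ h₃ (fun x hx => (hzs x hx).2.2.1) i₃, mono _ _ h₄ (fun x hx => (hzs x hx).2.2.2) i₄⟩
  exact absurd hs (not_le.2 this)

section Cone

variable {α β L : ℝ} {x₁ x₂ x₃ x₄ k : ℝ → ℝ}

/-- The nonnegative cone is forward invariant for the cooperative system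
`x₁' = x₂`, `x₂' = α x₁ + x₃`, `x₃' = x₄`, `x₄' = β x₃ + k`. -/
lemma nonneg_of_cooperative (hα : 0 < α) (hβ : 0 < β) (hL : 0 ≤ L)
    (h₁ : ∀ t, HasDerivAt x₁ (x₂ t) t) (h₂ : ∀ t, HasDerivAt x₂ (α * x₁ t + x₃ t) t)
    (h₃ : ∀ t, HasDerivAt x₃ (x₄ t) t) (h₄ : ∀ t, HasDerivAt x₄ (β * x₃ t + k t) t)
    (hk : ∀ t, -L * max (-x₁ t) 0 ≤ k t)
    (i₁ : 0 ≤ x₁ 0) (i₂ : 0 ≤ x₂ 0) (i₃ : 0 ≤ x₃ 0) (i₄ : 0 ≤ x₄ 0) {t : ℝ} (ht : 0 ≤ t) :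
    0 ≤ x₁ t ∧ 0 ≤ x₂ t ∧ 0 ≤ x₃ t ∧ 0 ≤ x₄ t := by
  set μ := α + β + L + 2 with hμ
  have key : ∀ ε > 0, 0 < x₁ t + ε * Real.exp (μ * t) ∧ 0 < x₂ t + ε * Real.exp (μ * t) ∧
      0 < x₃ t + ε * Real.exp (μ * t) ∧ 0 < x₄ t + ε * Real.exp (μ * t) := by
    intro ε hε
    have hE : ∀ t, HasDerivAt (fun t => ε * Real.exp (μ * t)) (μ * (ε * Real.exp (μ * t))) t := by
      intro t
      refine ((((hasDerivAt_id t).const_mul μ).exp).const_mul ε).congr_deriv ?_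
      simp only [id]
      ring
    refine pos_of_deriv_nonneg (fun t => (h₁ t).fun_add (hE t)) (fun t => (h₂ t).fun_add (hE t))
      (fun t => (h₃ t).fun_add (hE t)) (fun t => (h₄ t).fun_add (hE t)) ?_ ?_ ?_ ?_ ?_ ht
    · intro t
      have hEp : 0 < ε * Real.exp (μ * t) := by positivity
      have hkt := hk t
      generalize ε * Real.exp (μ * t) = e at *
      intro a₁ a₂ a₃ a₄
      have hmax : max (-x₁ t) 0 ≤ e := max_le (by linarith) hEp.le
      have := mul_le_mul_of_nonneg_left hmax hL
      have t1 : 0 ≤ α * (x₁ t + e) := mul_nonneg hα.le a₁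
      have t2 : 0 ≤ β * (x₃ t + e) := mul_nonneg hβ.le a₃
      have t3 : 0 < α * e := mul_pos hα hEp
      have t4 : 0 < β * e := mul_pos hβ hEp
      have t5 : 0 ≤ L * e := mul_nonneg hL hEp.le
      rw [hμ]
      refine ⟨?_, ?_, ?_, ?_⟩ <;> nlinarith
    all_goals
      simp only [mul_zero, Real.exp_zero, mul_one]
      linarith
  have lim : ∀ x : ℝ, (∀ ε > 0, 0 < x + ε * Real.exp (μ * t)) → 0 ≤ x := by
    intro x hx
    by_contra hneg
    have := hx (-x / Real.exp (μ * t)) (div_pos (by linarith) (Real.exp_pos _))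
    rw [div_mul_cancel₀ _ (Real.exp_pos _).ne'] at this
    linarith
  exact ⟨lim _ fun ε hε => (key ε hε).1, lim _ fun ε hε => (key ε hε).2.1,
    lim _ fun ε hε => (key ε hε).2.2.1, lim _ fun ε hε => (key ε hε).2.2.2⟩

/-- A solution of the cooperative system which starts in the nonnegative cone and whose first
component is bounded above vanishes. -/
lemma eq_zero_of_cooperative (hα : 0 < α) (hβ : 0 < β) (hL : 0 ≤ L)
    (h₁ : ∀ t, HasDerivAt x₁ (x₂ t) t) (h₂ : ∀ t, HasDerivAt x₂ (α * x₁ t + x₃ t) t)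
    (h₃ : ∀ t, HasDerivAt x₃ (x₄ t) t) (h₄ : ∀ t, HasDerivAt x₄ (β * x₃ t + k t) t)
    (hk : ∀ t, -L * max (-x₁ t) 0 ≤ k t) (hb : ∃ M, ∀ t, x₁ t ≤ M)
    (i₁ : 0 ≤ x₁ 0) (i₂ : 0 ≤ x₂ 0) (i₃ : 0 ≤ x₃ 0) (i₄ : 0 ≤ x₄ 0) {t : ℝ} (ht : 0 ≤ t) :
    x₁ t = 0 ∧ x₂ t = 0 ∧ x₃ t = 0 ∧ x₄ t = 0 := by
  have hnn : ∀ t, 0 ≤ t → 0 ≤ x₁ t ∧ 0 ≤ x₂ t ∧ 0 ≤ x₃ t ∧ 0 ≤ x₄ t := fun t ht =>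
    nonneg_of_cooperative hα hβ hL h₁ h₂ h₃ h₄ hk i₁ i₂ i₃ i₄ ht
  have hknn : ∀ t, 0 ≤ t → 0 ≤ k t := by
    intro t ht
    have := hk t
    rwa [max_eq_right (by linarith [(hnn t ht).1]), mul_zero] at this
  have mono : ∀ y z : ℝ → ℝ, (∀ t, HasDerivAt y (z t) t) → (∀ t, 0 ≤ t → 0 ≤ z t) →
      MonotoneOn y (Ici 0) := by
    intro y z hy hz
    refine monotoneOn_of_deriv_nonneg (convex_Ici _)
        (fun x _ => (hy x).continuousAt.continuousWithinAt)
        (fun x _ => (hy x).differentiableAt.differentiableWithinAt) ?_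
    intro x hx
    rw [interior_Ici] at hx
    rw [(hy x).deriv]
    exact hz x (le_of_lt hx)
  have m₁ := mono _ _ h₁ fun t ht => (hnn t ht).2.1
  have m₂ := mono _ _ h₂ fun t ht =>
    add_nonneg (mul_nonneg hα.le (hnn t ht).1) (hnn t ht).2.2.1
  have m₃ := mono _ _ h₃ fun t ht => (hnn t ht).2.2.2
  have m₄ := mono _ _ h₄ fun t ht =>
    add_nonneg (mul_nonneg hβ.le (hnn t ht).2.2.1) (hknn t ht)
  have z₂ : ∀ t, 0 ≤ t → x₂ t = 0 := by
    intro t ht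
    refine le_antisymm ?_ (hnn t ht).2.1
    by_contra hpos
    rw [not_le] at hpos
    obtain ⟨M, hM⟩ := hb
    have hM0 : 0 ≤ M := (hnn t ht).1.trans (hM t)
    have grow : MonotoneOn (fun s => x₁ s - x₂ t * s) (Ici t) := by
      have hd : ∀ s, HasDerivAt (fun s => x₁ s - x₂ t * s) (x₂ s - x₂ t) s := by
        intro s
        simpa using (h₁ s).fun_sub ((hasDerivAt_id s).const_mul (x₂ t))
      refine monotoneOn_of_deriv_nonneg (convex_Ici _)
        (fun x _ => (hd x).continuousAt.continuousWithinAt)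
        (fun x _ => (hd x).differentiableAt.differentiableWithinAt) ?_
      intro x hx
      rw [interior_Ici] at hx
      rw [(hd x).deriv, sub_nonneg]
      exact m₂ ht (ht.trans (le_of_lt hx)) (le_of_lt hx)
    have hs : t ≤ t + (M + 1) / x₂ t := by
      have : 0 ≤ (M + 1) / x₂ t := by positivity
      linarith
    have := grow (mem_Ici.2 le_rfl) (mem_Ici.2 hs) hs
    have e : x₂ t * (t + (M + 1) / x₂ t) = x₂ t * t + (M + 1) := by
      field_simp
    simp only [e] at this
    linarith [hM (t + (M + 1) / x₂ t), (hnn t ht).1]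
  -- a function vanishing on a half-line has vanishing derivative there
  have dz : ∀ y z : ℝ → ℝ, (∀ t, HasDerivAt y (z t) t) → (∀ t, 0 ≤ t → y t = 0) →
      ∀ t, 0 ≤ t → z t = 0 := by
    intro y z hy h0 t ht
    have e1 : HasDerivWithinAt y (z t) (Ici t) t := (hy t).hasDerivWithinAt
    have e2 : HasDerivWithinAt y 0 (Ici t) t :=
      (hasDerivWithinAt_const t (Ici t) (0 : ℝ)).congr
        (fun s hs => h0 s (ht.trans hs)) (h0 t ht)
    exact (uniqueDiffWithinAt_Ici t).eq_deriv _ e1 e2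
  have z₁₃ := dz _ _ h₂ z₂
  have z₁ : ∀ t, 0 ≤ t → x₁ t = 0 := by
    intro t ht
    have a := z₁₃ t ht
    have b := hnn t ht
    have : α * x₁ t = 0 := le_antisymm (by linarith) (mul_nonneg hα.le b.1)
    exact (mul_eq_zero.1 this).resolve_left hα.ne'
  have z₃ : ∀ t, 0 ≤ t → x₃ t = 0 := by
    intro t ht
    have a := z₁₃ t ht
    rw [z₁ t ht] at a
    linarith
  exact ⟨z₁ t ht, z₂ t ht, z₃ t ht, dz _ _ h₃ z₃ t ht⟩

end Cone

/-- The properties of the nonlinearity `g` that the argument uses: it is nondecreasing and locally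
Lipschitz on the positive half-line, and `x ↦ g x - α β x` has primitive `G` and at most one zero
there. -/
structure IsNonlinearity (α β : ℝ) (g G : ℝ → ℝ) : Prop where
  pos : 0 < α
  lt : α < β
  mono : ∀ x y, 0 < x → x ≤ y → g x ≤ g y
  lipschitz : ∀ K, ∃ L, 0 ≤ L ∧ ∀ x y, 0 < x → x ≤ y → y ≤ K → g y - g x ≤ L * (y - x)
  unique_zero : ∀ x y, 0 < x → 0 < y → g x = α * β * x → g y = α * β * y → x = y
  primitive : ∀ x, 0 < x → HasDerivAt G (g x - α * β * x) x

/-- `v` is a positive periodic solution of `v'''' - (α + β) v'' + α β v = g v`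
with successive derivatives `p`, `q`, `r`. -/
structure IsSolution (α β : ℝ) (g v p q r : ℝ → ℝ) : Prop where
  deriv_v : ∀ t, HasDerivAt v (p t) t
  deriv_p : ∀ t, HasDerivAt p (q t) t
  deriv_q : ∀ t, HasDerivAt q (r t) t
  deriv_r : ∀ t, HasDerivAt r ((α + β) * q t - α * β * v t + g (v t)) t
  pos : ∀ t, 0 < v t
  periodic : ∃ T > 0, Function.Periodic v T

/-- The conserved energy of `v'''' - (α + β) v'' + α β v = g v`. -/
noncomputable def energy (α β : ℝ) (G v p q r : ℝ → ℝ) (t : ℝ) : ℝ :=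
  -(p t) * r t + 1 / 2 * q t ^ 2 + (α + β) / 2 * p t ^ 2 + G (v t)

variable {α β : ℝ} {g G v p q r v₁ p₁ q₁ r₁ v₂ p₂ q₂ r₂ : ℝ → ℝ}

namespace IsSolution

lemma continuous_v (S : IsSolution α β g v p q r) : Continuous v :=
  continuous_iff_continuousAt.2 fun t => (S.deriv_v t).continuousAt

lemma continuous_p (S : IsSolution α β g v p q r) : Continuous p :=
  continuous_iff_continuousAt.2 fun t => (S.deriv_p t).continuousAt

lemma continuous_r (S : IsSolution α β g v p q r) : Continuous r :=
  continuous_iff_continuousAt.2 fun t => (S.deriv_r t).continuousAt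

lemma bddAbove (S : IsSolution α β g v p q r) : ∃ M, ∀ t, v t ≤ M := by
  obtain ⟨T, hT, hper⟩ := S.periodic
  obtain ⟨M, hM⟩ := (hper.isBounded_of_continuous hT.ne' S.continuous_v).bddAbove
  exact ⟨M, fun t => hM ⟨t, rfl⟩⟩

lemma shift (S : IsSolution α β g v p q r) (s : ℝ) :
    IsSolution α β g (fun t => v (s + t)) (fun t => p (s + t)) (fun t => q (s + t))
      (fun t => r (s + t)) where
  deriv_v t := (S.deriv_v (s + t)).comp_const_add s t
  deriv_p t := (S.deriv_p (s + t)).comp_const_add s t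
  deriv_q t := (S.deriv_q (s + t)).comp_const_add s t
  deriv_r t := (S.deriv_r (s + t)).comp_const_add s t
  pos t := S.pos _
  periodic := by
    obtain ⟨T, hT, hper⟩ := S.periodic
    refine ⟨T, hT, fun t => ?_⟩
    simp only [← add_assoc]
    exact hper _

lemma reflect (S : IsSolution α β g v p q r) :
    IsSolution α β g (fun t => v (-t)) (fun t => -p (-t)) (fun t => q (-t))
      (fun t => -r (-t)) where
  deriv_v t := ((S.deriv_v (-t)).scomp t (hasDerivAt_neg t)).congr_deriv (by simp)
  deriv_p t := by simpa using ((S.deriv_p (-t)).scomp t (hasDerivAt_neg t)).fun_neg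
  deriv_q t := ((S.deriv_q (-t)).scomp t (hasDerivAt_neg t)).congr_deriv (by simp)
  deriv_r t := by simpa using ((S.deriv_r (-t)).scomp t (hasDerivAt_neg t)).fun_neg
  pos t := S.pos _
  periodic := by
    obtain ⟨T, hT, hper⟩ := S.periodic
    refine ⟨T, hT, fun t => ?_⟩
    simp only [neg_add, ← sub_eq_add_neg]
    exact hper.sub_eq _

/-- Two solutions whose difference lies initially in the nonnegative cone agree forward in time. -/
lemma eq_of_cone (hg : IsNonlinearity α β g G) (S₁ : IsSolution α β g v₁ p₁ q₁ r₁)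
    (S₂ : IsSolution α β g v₂ p₂ q₂ r₂) (i₁ : 0 ≤ v₁ 0 - v₂ 0) (i₂ : 0 ≤ p₁ 0 - p₂ 0)
    (i₃ : 0 ≤ q₁ 0 - q₂ 0 - α * (v₁ 0 - v₂ 0)) (i₄ : 0 ≤ r₁ 0 - r₂ 0 - α * (p₁ 0 - p₂ 0))
    {t : ℝ} (ht : 0 ≤ t) : v₁ t = v₂ t ∧ p₁ t = p₂ t ∧ q₁ t = q₂ t ∧ r₁ t = r₂ t := by
  obtain ⟨M₁, hM₁⟩ := S₁.bddAbove
  obtain ⟨M₂, hM₂⟩ := S₂.bddAbove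
  obtain ⟨L, hL, hlip⟩ := hg.lipschitz M₂
  have key := eq_zero_of_cooperative (α := α) (β := β) (L := L)
    (x₁ := fun t => v₁ t - v₂ t) (x₂ := fun t => p₁ t - p₂ t)
    (x₃ := fun t => q₁ t - q₂ t - α * (v₁ t - v₂ t))
    (x₄ := fun t => r₁ t - r₂ t - α * (p₁ t - p₂ t))
    (k := fun t => g (v₁ t) - g (v₂ t)) hg.pos (hg.pos.trans hg.lt) hL
    (fun t => (S₁.deriv_v t).fun_sub (S₂.deriv_v t))
    (fun t => ((S₁.deriv_p t).fun_sub (S₂.deriv_p t)).congr_deriv (by ring))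
    (fun t => ((S₁.deriv_q t).fun_sub (S₂.deriv_q t)).fun_sub
      (((S₁.deriv_v t).fun_sub (S₂.deriv_v t)).const_mul α))
    (fun t => (((S₁.deriv_r t).fun_sub (S₂.deriv_r t)).fun_sub
      (((S₁.deriv_p t).fun_sub (S₂.deriv_p t)).const_mul α)).congr_deriv (by ring))
    (fun t => ?_) ⟨M₁, fun t => ?_⟩ i₁ i₂ i₃ i₄ ht
  · obtain ⟨a, b, c, d⟩ := key
    have a' : v₁ t - v₂ t = 0 := a
    have b' : p₁ t - p₂ t = 0 := b
    simp only [a', b', mul_zero, sub_zero] at c d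
    exact ⟨by linarith, by linarith, by linarith, by linarith⟩
  · rcases le_total (v₂ t) (v₁ t) with h | h
    · rw [max_eq_right (by linarith), mul_zero]
      linarith [hg.mono _ _ (S₂.pos t) h]
    · rw [max_eq_left (by linarith)]
      linarith [hlip _ _ (S₁.pos t) h (hM₂ t)]
  · linarith [hM₁ t, S₂.pos t]

/-- Solutions are determined by the value and first derivative at one point. -/
lemma eq_of_eq (hg : IsNonlinearity α β g G) (S₁ : IsSolution α β g v₁ p₁ q₁ r₁)
    (S₂ : IsSolution α β g v₂ p₂ q₂ r₂) {s₁ s₂ : ℝ} (hv : v₁ s₁ = v₂ s₂) (hp : p₁ s₁ = p₂ s₂)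
    (t : ℝ) : v₁ (s₁ + t) = v₂ (s₂ + t) ∧ p₁ (s₁ + t) = p₂ (s₂ + t) ∧
      q₁ (s₁ + t) = q₂ (s₂ + t) ∧ r₁ (s₁ + t) = r₂ (s₂ + t) := by
  have initial : q₁ s₁ = q₂ s₂ ∧ r₁ s₁ = r₂ s₂ := by
    have aux : ∀ {v₁ p₁ q₁ r₁ v₂ p₂ q₂ r₂ : ℝ → ℝ} (_ : IsSolution α β g v₁ p₁ q₁ r₁)
        (_ : IsSolution α β g v₂ p₂ q₂ r₂), v₁ 0 = v₂ 0 → p₁ 0 = p₂ 0 → q₂ 0 ≤ q₁ 0 →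
        q₁ 0 = q₂ 0 ∧ r₁ 0 = r₂ 0 := by
      intro v₁ p₁ q₁ r₁ v₂ p₂ q₂ r₂ S₁ S₂ hv hp hq
      rcases le_total (r₂ 0) (r₁ 0) with hr | hr
      · exact (eq_of_cone hg S₁ S₂ (by simp [hv]) (by simp [hp]) (by simpa [hv] using hq)
          (by simpa [hp] using hr) le_rfl).2.2
      · have := (eq_of_cone hg S₁.reflect S₂.reflect (by simp [hv]) (by simp [hp])
          (by simpa [hv] using hq) (by simpa [hp] using hr) le_rfl).2.2
        simpa using this
    rcases le_total (q₂ s₂) (q₁ s₁) with hq | hq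
    · simpa using aux (S₁.shift s₁) (S₂.shift s₂) (by simpa) (by simpa) (by simpa)
    · have := aux (S₂.shift s₂) (S₁.shift s₁) (by simpa using hv.symm) (by simpa using hp.symm)
        (by simpa)
      simpa [eq_comm] using this
  rcases le_total 0 t with ht | ht
  · exact eq_of_cone hg (S₁.shift s₁) (S₂.shift s₂) (by simp [hv]) (by simp [hp])
      (by simp [hv, initial]) (by simp [hp, initial]) ht
  · have := eq_of_cone hg (S₁.shift s₁).reflect (S₂.shift s₂).reflect (by simp [hv])
      (by simp [hp]) (by simp [hv, initial]) (by simp [hp, initial]) (neg_nonneg.2 ht)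
    simpa using this

/-- At a common value, the solution with the larger first derivative has a comparatively small
third derivative. -/
lemma third_deriv_sub_le (hg : IsNonlinearity α β g G) (S₁ : IsSolution α β g v₁ p₁ q₁ r₁)
    (S₂ : IsSolution α β g v₂ p₂ q₂ r₂) {s₁ s₂ : ℝ} (hv : v₁ s₁ = v₂ s₂) (hp : p₁ s₁ < p₂ s₂) :
    r₂ s₂ - r₁ s₁ ≤ α * (p₂ s₂ - p₁ s₁) := by
  by_contra! hr
  rcases le_total (q₁ s₁) (q₂ s₂) with hq | hq
  · have := (eq_of_cone hg (S₂.shift s₂) (S₁.shift s₁) (by simp [hv]) (by simpa using hp.le)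
      (by simpa [hv] using hq) (by simpa using hr.le) le_rfl).2.1
    simp at this
    linarith
  · have := (eq_of_cone hg (S₁.shift s₁).reflect (S₂.shift s₂).reflect (by simp [hv])
      (by simpa using hp.le) (by simpa [hv] using hq) (by simp; linarith) le_rfl).2.1
    simp at this
    linarith

/-- Solutions are even about their critical points, so odd derivatives vanish there. -/
lemma third_deriv_eq_zero (hg : IsNonlinearity α β g G) (S : IsSolution α β g v p q r) {c : ℝ}
    (hc : p c = 0) : r c = 0 := by
  have := (eq_of_eq hg S (S.shift c).reflect (s₁ := c) (s₂ := 0) (by simp) (by simp [hc]) 0).2.2.2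
  simp at this
  linarith

lemma deriv_reflect (hg : IsNonlinearity α β g G) (S : IsSolution α β g v p q r) {c : ℝ}
    (hc : p c = 0) (t : ℝ) : p (c + t) = -p (c - t) := by
  have := (eq_of_eq hg S (S.shift c).reflect (s₁ := c) (s₂ := 0) (by simp) (by simp [hc]) t).2.1
  simpa [sub_eq_add_neg] using this

lemma energy_const (hg : IsNonlinearity α β g G) (S : IsSolution α β g v p q r) (s t : ℝ) :
    energy α β G v p q r s = energy α β G v p q r t := by
  have hd : ∀ t, HasDerivAt (energy α β G v p q r) 0 t := by
    intro t
    have h := ((((S.deriv_p t).fun_neg.fun_mul (S.deriv_r t)).fun_add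
      (((S.deriv_q t).fun_pow 2).const_mul (1 / 2))).fun_add
      (((S.deriv_p t).fun_pow 2).const_mul ((α + β) / 2))).fun_add
      ((hg.primitive _ (S.pos t)).comp t (S.deriv_v t))
    refine h.congr_deriv ?_
    push_cast
    ring
  exact is_const_of_deriv_eq_zero (fun t => (hd t).differentiableAt) (fun t => (hd t).deriv) s t

/-- On a half-period where `v` increases, `v''' ≤ α v'`. -/
lemma third_deriv_le (hg : IsNonlinearity α β g G) (S : IsSolution α β g v p q r) {a b : ℝ}
    (hab : a < b) (hpa : p a = 0) (hpb : p b = 0) (hp : ∀ t ∈ Ioo a b, 0 < p t) :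
    ∀ t ∈ Icc a b, r t ≤ α * p t := by
  set f : ℝ → ℝ := fun t => r t - α * p t with hf
  have hfa : f a = 0 := by simp [hf, hpa, S.third_deriv_eq_zero hg hpa]
  have hfb : f b = 0 := by simp [hf, hpb, S.third_deriv_eq_zero hg hpb]
  have df : ∀ t, HasDerivAt f (β * (q t - α * v t) + g (v t)) t := fun t =>
    ((S.deriv_r t).fun_sub ((S.deriv_p t).const_mul α)).congr_deriv (by ring)
  have dF : ∀ t, HasDerivAt (fun t => q t - α * v t) (f t) t := fun t =>
    (S.deriv_q t).fun_sub ((S.deriv_v t).const_mul α)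
  have cf : Continuous f := continuous_iff_continuousAt.2 fun t => (df t).continuousAt
  obtain ⟨c, hc, hmax⟩ := isCompact_Icc.exists_isMaxOn (nonempty_Icc.2 hab.le) cf.continuousOn
  suffices f c ≤ 0 by
    intro t ht
    have : f t ≤ f c := hmax ht
    simp only [hf] at *
    linarith
  by_contra! hpos
  have hac : a < c := lt_of_le_of_ne hc.1 (by rintro rfl; linarith)
  have hcb : c < b := lt_of_le_of_ne hc.2 (by rintro rfl; linarith)
  have hcrit : β * (q c - α * v c) + g (v c) = 0 :=
    (hmax.isLocalMax (Icc_mem_nhds hac hcb)).hasDerivAt_eq_zero (df c)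
  obtain ⟨d, hcd, hd⟩ : ∃ d, c < d ∧ Icc c d ⊆ {x | 0 < f x} ∩ Iio b := by
    have : {x | 0 < f x} ∩ Iio b ∈ 𝓝 c :=
      inter_mem (cf.continuousAt.eventually (lt_mem_nhds hpos)) (Iio_mem_nhds hcb)
    obtain ⟨d, hd, hsub⟩ := mem_nhdsGE_iff_exists_Icc_subset.1 (mem_nhdsWithin_of_mem_nhds this)
    exact ⟨d, hd, hsub⟩
  have monoF : StrictMonoOn (fun t => q t - α * v t) (Icc c d) := by
    refine strictMonoOn_of_deriv_pos (convex_Icc _ _)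
      (fun x _ => (dF x).continuousAt.continuousWithinAt) fun x hx => ?_
    rw [(dF x).deriv]
    exact (hd (interior_subset hx)).1
  have monov : StrictMonoOn v (Icc c d) := by
    refine strictMonoOn_of_deriv_pos (convex_Icc _ _) S.continuous_v.continuousOn fun x hx => ?_
    rw [(S.deriv_v x).deriv]
    have := hd (interior_subset hx)
    rw [interior_Icc] at hx
    exact hp x ⟨hac.trans hx.1, this.2⟩
  have monof : StrictMonoOn f (Icc c d) := by
    refine strictMonoOn_of_deriv_pos (convex_Icc _ _) cf.continuousOn fun x hx => ?_
    rw [(df x).deriv]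
    rw [interior_Icc] at hx
    have hcI : c ∈ Icc c d := ⟨le_rfl, hcd.le⟩
    have hxI : x ∈ Icc c d := ⟨hx.1.le, hx.2.le⟩
    have h1 := mul_lt_mul_of_pos_left (monoF hcI hxI hx.1) (hg.pos.trans hg.lt)
    have h2 := hg.mono _ _ (S.pos c) (monov hcI hxI hx.1).le
    simp only at h1
    linarith
  have h1 : f c < f d := monof ⟨le_rfl, hcd.le⟩ ⟨hcd.le, le_rfl⟩ hcd
  have h2 : f d ≤ f c := hmax ⟨hac.le.trans hcd.le, (hd ⟨hcd.le, le_rfl⟩).2.le⟩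
  linarith

end IsSolution

lemma exists_first_zero {f : ℝ → ℝ} (hf : Continuous f) {s c : ℝ} (hs : 0 < f s) (hsc : s < c)
    (hc : f c = 0) : ∃ b, s < b ∧ f b = 0 ∧ ∀ x, s ≤ x → x < b → 0 < f x := by
  have hcpt : IsCompact (Icc s c ∩ {x | f x = 0}) :=
    isCompact_Icc.inter_right (isClosed_eq hf continuous_const)
  obtain ⟨b, ⟨hb, hb0⟩, hleast⟩ := hcpt.exists_isLeast ⟨c, ⟨hsc.le, le_rfl⟩, hc⟩
  have hb0' : f b = 0 := hb0
  refine ⟨b, lt_of_le_of_ne hb.1 (by rintro rfl; linarith), hb0, fun x hsx hxb => ?_⟩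
  by_contra! hx
  obtain ⟨y, hy, hy0⟩ := intermediate_value_Icc' hsx hf.continuousOn ⟨hx, hs.le⟩
  exact absurd (hleast ⟨⟨hy.1, hy.2.trans (hxb.le.trans hb.2)⟩, hy0⟩)
    (not_le.2 (hy.2.trans_lt hxb))

/-- `[a, b]` is a half-period on which `v` increases from a minimum to a maximum. -/
structure IsBranch (v p : ℝ → ℝ) (a b : ℝ) : Prop where
  lt : a < b
  left : p a = 0
  right : p b = 0
  pos : ∀ t ∈ Ioo a b, 0 < p t

lemma IsBranch.nonneg {a b : ℝ} (B : IsBranch v p a b) {t : ℝ} (ht : t ∈ Icc a b) : 0 ≤ p t := by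
  rcases ht.1.eq_or_lt with rfl | h1
  · exact B.left.ge
  rcases ht.2.eq_or_lt with rfl | h2
  · exact B.right.ge
  exact (B.pos t ⟨h1, h2⟩).le

namespace IsSolution

lemma strictMonoOn_branch (S : IsSolution α β g v p q r) {a b : ℝ} (B : IsBranch v p a b) :
    StrictMonoOn v (Icc a b) := by
  refine strictMonoOn_of_deriv_pos (convex_Icc _ _) S.continuous_v.continuousOn fun x hx => ?_
  rw [(S.deriv_v x).deriv]
  rw [interior_Icc] at hx
  exact B.pos x hx

lemma exists_crit_between (S : IsSolution α β g v p q r) (s : ℝ) :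
    (∃ c, s < c ∧ p c = 0) ∧ ∃ c, c < s ∧ p c = 0 := by
  obtain ⟨T, hT, hper⟩ := S.periodic
  constructor
  · obtain ⟨c, hc, hc0⟩ := exists_hasDerivAt_eq_zero (f := v) (f' := p) (a := s) (b := s + T)
      (by linarith) S.continuous_v.continuousOn (hper s).symm fun x _ => S.deriv_v x
    exact ⟨c, hc.1, hc0⟩
  · obtain ⟨c, hc, hc0⟩ := exists_hasDerivAt_eq_zero (f := v) (f' := p) (a := s - T) (b := s)
      (by linarith) S.continuous_v.continuousOn (hper.sub_eq s) fun x _ => S.deriv_v x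
    exact ⟨c, hc.2, hc0⟩

lemma exists_branch (hg : IsNonlinearity α β g G) (S : IsSolution α β g v p q r)
    (hne : ∃ t, p t ≠ 0) : ∃ a b, IsBranch v p a b := by
  obtain ⟨s, hs⟩ : ∃ s, 0 < p s := by
    obtain ⟨t, ht⟩ := hne
    rcases ht.lt_or_gt with h | h
    · obtain ⟨c, -, hc⟩ := (S.exists_crit_between t).1
      refine ⟨c + (c - t), ?_⟩
      rw [S.deriv_reflect hg hc]
      simpa using h
    · exact ⟨t, h⟩
  obtain ⟨⟨c, hsc, hc⟩, c', hcs', hc'⟩ := S.exists_crit_between s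
  obtain ⟨b, hsb, hb0, hb⟩ := exists_first_zero S.continuous_p hs hsc hc
  obtain ⟨a, hsa, ha0, ha⟩ := exists_first_zero (f := fun x => p (-x)) (s := -s) (c := -c')
    (S.continuous_p.comp continuous_neg) (by simpa) (by linarith) (by simpa)
  refine ⟨-a, b, by linarith, ha0, hb0, fun t ht => ?_⟩
  rcases le_total s t with h | h
  · exact hb t h ht.2
  · simpa using ha (-t) (by linarith) (by linarith [ht.1])

/-- Every increasing half-period crosses a zero of `x ↦ g x - α β x`. -/
lemma exists_zero_of_branch (hg : IsNonlinearity α β g G) (S : IsSolution α β g v p q r) {a b : ℝ}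
    (B : IsBranch v p a b) : ∃ t ∈ Ioo a b, g (v t) = α * β * v t := by
  obtain ⟨c, hc, hc0⟩ := exists_hasDerivAt_eq_zero (f := fun t => r t - (α + β) * p t)
    (f' := fun t => g (v t) - α * β * v t) B.lt
    (S.continuous_r.sub (continuous_const.mul S.continuous_p)).continuousOn
    (by simp [B.left, B.right, S.third_deriv_eq_zero hg B.left, S.third_deriv_eq_zero hg B.right])
    fun x _ => ((S.deriv_r x).fun_sub ((S.deriv_p x).const_mul (α + β))).congr_deriv (by ring)
  exact ⟨c, hc, by linarith⟩

/-- On an increasing half-period, `v` has a continuous inverse. -/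
lemma exists_inverse (S : IsSolution α β g v p q r) {a b : ℝ} (B : IsBranch v p a b) :
    ∃ σ : ℝ → ℝ, Continuous σ ∧ (∀ u, σ u ∈ Icc a b) ∧ (∀ t ∈ Icc a b, σ (v t) = t) ∧
      ∀ u ∈ Icc (v a) (v b), v (σ u) = u := by
  have hm := S.strictMonoOn_branch B
  have himg : v '' Icc a b = Icc (v a) (v b) := by
    refine Subset.antisymm ?_ (intermediate_value_Icc B.lt.le S.continuous_v.continuousOn)
    rintro _ ⟨t, ht, rfl⟩
    exact ⟨hm.monotoneOn ⟨le_rfl, B.lt.le⟩ ht ht.1, hm.monotoneOn ht ⟨B.lt.le, le_rfl⟩ ht.2⟩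
  have hle : v a ≤ v b := hm.monotoneOn ⟨le_rfl, B.lt.le⟩ ⟨B.lt.le, le_rfl⟩ B.lt.le
  let e : Icc a b ≃o Icc (v a) (v b) := (hm.orderIso v (Icc a b)).trans (OrderIso.setCongr _ _ himg)
  have he : ∀ x : Icc a b, (e x : ℝ) = v x := fun x => rfl
  have hinv : ∀ u ∈ Icc (v a) (v b), v (IccExtend hle (fun x => (e.symm x : ℝ)) u) = u := by
    intro u hu
    rw [IccExtend_of_mem _ _ hu, ← he, OrderIso.apply_symm_apply]
  refine ⟨IccExtend hle (fun x => (e.symm x : ℝ)), ?_, fun u => (e.symm _).2, fun t ht => ?_, hinv⟩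
  · exact (continuous_subtype_val.comp e.symm.continuous).Icc_extend'
  · refine hm.injOn (e.symm _).2 ht (hinv _ ?_)
    rw [← himg]
    exact ⟨t, ht, rfl⟩

/-- The energy comparison at a common value of two solutions. -/
lemma energy_lt (hg : IsNonlinearity α β g G) (S₁ : IsSolution α β g v₁ p₁ q₁ r₁)
    (S₂ : IsSolution α β g v₂ p₂ q₂ r₂) {s t : ℝ} (hv : v₁ s = v₂ t) (hp₁ : 0 ≤ p₁ s)
    (hp : p₁ s < p₂ t) (hr : r₁ s ≤ α * p₁ s) (hq : q₁ s ^ 2 ≤ q₂ t ^ 2) :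
    energy α β G v₁ p₁ q₁ r₁ s < energy α β G v₂ p₂ q₂ r₂ t := by
  have h := third_deriv_sub_le hg S₁ S₂ hv hp
  have hlt := hg.lt
  unfold energy
  rw [hv]
  have h1 := mul_le_mul_of_nonneg_left h (hp₁.trans hp.le)
  have h2 := mul_le_mul_of_nonneg_left hr (sub_nonneg.2 hp.le)
  have h3 : 0 < (β - α) / 2 * ((p₂ t - p₁ s) * (p₂ t + p₁ s)) :=
    mul_pos (by linarith) (mul_pos (by linarith) (by linarith))
  nlinarith

/-- If the increasing half-period of one solution lies strictly below that of another in the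
phase plane, then its energy is strictly smaller. -/
lemma energy_lt_of_branch (hg : IsNonlinearity α β g G) (S₁ : IsSolution α β g v₁ p₁ q₁ r₁)
    (S₂ : IsSolution α β g v₂ p₂ q₂ r₂) {a₁ b₁ a₂ b₂ : ℝ} (B₁ : IsBranch v₁ p₁ a₁ b₁)
    (B₂ : IsBranch v₂ p₂ a₂ b₂)
    (hlt : ∀ s ∈ Icc a₁ b₁, ∀ t ∈ Icc a₂ b₂, v₁ s = v₂ t → p₁ s < p₂ t) :
    energy α β G v₁ p₁ q₁ r₁ 0 < energy α β G v₂ p₂ q₂ r₂ 0 := by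
  have m₁ := S₁.strictMonoOn_branch B₁
  have m₂ := S₂.strictMonoOn_branch B₂
  have a₁I : a₁ ∈ Icc a₁ b₁ := ⟨le_rfl, B₁.lt.le⟩
  have b₁I : b₁ ∈ Icc a₁ b₁ := ⟨B₁.lt.le, le_rfl⟩
  have a₂I : a₂ ∈ Icc a₂ b₂ := ⟨le_rfl, B₂.lt.le⟩
  have b₂I : b₂ ∈ Icc a₂ b₂ := ⟨B₂.lt.le, le_rfl⟩
  obtain ⟨s₀, hs₀, es₀⟩ := S₁.exists_zero_of_branch hg B₁
  obtain ⟨t₀, ht₀, et₀⟩ := S₂.exists_zero_of_branch hg B₂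
  have h₀ : v₁ s₀ = v₂ t₀ := hg.unique_zero _ _ (S₁.pos _) (S₂.pos _) es₀ et₀
  have hs₀' := Ioo_subset_Icc_self hs₀
  have ht₀' := Ioo_subset_Icc_self ht₀
  have hleft : v₂ a₂ < v₁ a₁ := by
    by_contra! h
    obtain ⟨s, hs, hsv⟩ := intermediate_value_Icc hs₀.1.le S₁.continuous_v.continuousOn
      ⟨h, h₀ ▸ m₂.monotoneOn a₂I ht₀' ht₀.1.le⟩
    have hs' : s ∈ Icc a₁ b₁ := ⟨hs.1, hs.2.trans hs₀.2.le⟩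
    have := hlt s hs' a₂ a₂I hsv
    linarith [B₁.nonneg hs', B₂.left]
  have hright : v₁ b₁ < v₂ b₂ := by
    by_contra! h
    obtain ⟨s, hs, hsv⟩ := intermediate_value_Icc hs₀.2.le S₁.continuous_v.continuousOn
      ⟨h₀ ▸ m₂.monotoneOn ht₀' b₂I ht₀.2.le, h⟩
    have hs' : s ∈ Icc a₁ b₁ := ⟨hs₀.1.le.trans hs.1, hs.2⟩
    have := hlt s hs' b₂ b₂I hsv
    linarith [B₁.nonneg hs', B₂.right]
  have hrange : ∀ s ∈ Icc a₁ b₁, v₁ s ∈ Ioo (v₂ a₂) (v₂ b₂) := fun s hs =>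
    ⟨hleft.trans_le (m₁.monotoneOn a₁I hs hs.1), (m₁.monotoneOn hs b₁I hs.2).trans_lt hright⟩
  obtain ⟨σ, cσ, hσI, -, hσ⟩ := S₂.exists_inverse B₂
  have hσ' : ∀ s ∈ Icc a₁ b₁, p₁ s < p₂ (σ (v₁ s)) := fun s hs =>
    hlt s hs _ (hσI _) (hσ _ (Ioo_subset_Icc_self (hrange s hs))).symm
  have hp₂ : ∀ s ∈ Icc a₁ b₁, 0 < p₂ (σ (v₁ s)) := fun s hs =>
    (B₁.nonneg hs).trans_lt (hσ' s hs)
  have cφ : ContinuousOn (fun s => p₁ s / p₂ (σ (v₁ s))) (Icc a₁ b₁) :=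
    S₁.continuous_p.continuousOn.div
      (S₂.continuous_p.comp (cσ.comp S₁.continuous_v)).continuousOn fun s hs => (hp₂ s hs).ne'
  obtain ⟨c, hc, hmax⟩ := isCompact_Icc.exists_isMaxOn (nonempty_Icc.2 B₁.lt.le) cφ
  have hpos : 0 < p₁ c / p₂ (σ (v₁ c)) :=
    (div_pos (B₁.pos _ hs₀) (hp₂ _ hs₀')).trans_le (hmax hs₀')
  have hac : a₁ < c := lt_of_le_of_ne hc.1 (by rintro rfl; simp [B₁.left] at hpos)
  have hcb : c < b₁ := lt_of_le_of_ne hc.2 (by rintro rfl; simp [B₁.right] at hpos)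
  have hw := hp₂ c hc
  have hvw : v₂ (σ (v₁ c)) = v₁ c := hσ _ (Ioo_subset_Icc_self (hrange c hc))
  have dσ : HasDerivAt σ (p₂ (σ (v₁ c)))⁻¹ (v₁ c) := by
    refine HasDerivAt.of_local_left_inverse cσ.continuousAt (S₂.deriv_v _) hw.ne' ?_
    filter_upwards [Ioo_mem_nhds (hrange c hc).1 (hrange c hc).2] with u hu
    exact hσ u (Ioo_subset_Icc_self hu)
  have dφ := (S₁.deriv_p c).fun_div
    ((S₂.deriv_p (σ (v₁ c))).comp c (dσ.comp c (S₁.deriv_v c))) hw.ne'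
  have hcrit := (hmax.isLocalMax (Icc_mem_nhds hac hcb)).hasDerivAt_eq_zero dφ
  have hlt' := hσ' c hc
  have hp₁ := B₁.nonneg hc
  simp only [Function.comp_apply] at hcrit
  generalize σ (v₁ c) = w at *
  have hq : q₁ c * p₂ w ^ 2 = q₂ w * p₁ c ^ 2 := by
    rw [div_eq_zero_iff] at hcrit
    have := hcrit.resolve_right (by positivity)
    field_simp at this
    linarith
  have hsq : (q₁ c) ^ 2 ≤ (q₂ w) ^ 2 := by
    rw [sq_le_sq]
    have h1 : |q₁ c| * p₂ w ^ 2 = |q₂ w| * p₁ c ^ 2 := by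
      have := congrArg abs hq
      rwa [abs_mul, abs_mul, abs_of_nonneg (sq_nonneg (p₂ w)),
        abs_of_nonneg (sq_nonneg (p₁ c))] at this
    have h2 : p₁ c ^ 2 ≤ p₂ w ^ 2 := pow_le_pow_left₀ hp₁ hlt'.le 2
    refine le_of_mul_le_mul_right ?_ (pow_pos hw 2)
    rw [h1]
    exact mul_le_mul_of_nonneg_left h2 (abs_nonneg _)
  rw [S₁.energy_const hg 0 c, S₂.energy_const hg 0 w]
  exact energy_lt hg S₁ S₂ hvw.symm hp₁ hlt'
    (S₁.third_deriv_le hg B₁.lt B₁.left B₁.right B₁.pos c hc) hsq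

/-- Of two solutions without common phase, one lies strictly below the other. -/
lemma lt_or_gt_of_branch (S₁ : IsSolution α β g v₁ p₁ q₁ r₁)
    (S₂ : IsSolution α β g v₂ p₂ q₂ r₂) {a₁ b₁ a₂ b₂ : ℝ} (B₁ : IsBranch v₁ p₁ a₁ b₁)
    (B₂ : IsBranch v₂ p₂ a₂ b₂) (hne : ∀ s t, v₁ s = v₂ t → p₁ s ≠ p₂ t) :
    (∀ s ∈ Icc a₁ b₁, ∀ t ∈ Icc a₂ b₂, v₁ s = v₂ t → p₁ s < p₂ t) ∨
      ∀ t ∈ Icc a₂ b₂, ∀ s ∈ Icc a₁ b₁, v₂ t = v₁ s → p₂ t < p₁ s := by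
  by_contra! h
  obtain ⟨⟨s, hs, t, ht, hst, hle⟩, t', ht', s', hs', hst', hle'⟩ := h
  obtain ⟨σ₁, c₁, -, l₁, i₁⟩ := S₁.exists_inverse B₁
  obtain ⟨σ₂, c₂, -, l₂, i₂⟩ := S₂.exists_inverse B₂
  have m₁ := (S₁.strictMonoOn_branch B₁).monotoneOn
  have m₂ := (S₂.strictMonoOn_branch B₂).monotoneOn
  have a₁I : a₁ ∈ Icc a₁ b₁ := ⟨le_rfl, B₁.lt.le⟩
  have b₁I : b₁ ∈ Icc a₁ b₁ := ⟨B₁.lt.le, le_rfl⟩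
  have a₂I : a₂ ∈ Icc a₂ b₂ := ⟨le_rfl, B₂.lt.le⟩
  have b₂I : b₂ ∈ Icc a₂ b₂ := ⟨B₂.lt.le, le_rfl⟩
  have mem : ∀ s ∈ Icc a₁ b₁, ∀ t ∈ Icc a₂ b₂, v₁ s = v₂ t →
      v₁ s ∈ Icc (v₁ a₁) (v₁ b₁) ∩ Icc (v₂ a₂) (v₂ b₂) := fun s hs t ht h =>
    ⟨⟨m₁ a₁I hs hs.1, m₁ hs b₁I hs.2⟩, h ▸ ⟨m₂ a₂I ht ht.1, m₂ ht b₂I ht.2⟩⟩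
  have hconn : IsPreconnected (Icc (v₁ a₁) (v₁ b₁) ∩ Icc (v₂ a₂) (v₂ b₂)) :=
    (ordConnected_Icc.inter ordConnected_Icc).isPreconnected
  have cD : Continuous fun u => p₂ (σ₂ u) - p₁ (σ₁ u) :=
    (S₂.continuous_p.comp c₂).sub (S₁.continuous_p.comp c₁)
  obtain ⟨u, hu, hu0⟩ := hconn.intermediate_value (mem s hs t ht hst)
    (mem s' hs' t' ht' hst'.symm) cD.continuousOn (show (0 : ℝ) ∈ Icc _ _ from
      ⟨by rw [l₁ s hs, hst, l₂ t ht]; linarith, by rw [l₁ s' hs', ← hst', l₂ t' ht']; linarith⟩)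
  refine hne (σ₁ u) (σ₂ u) ((i₁ u hu.1).trans (i₂ u hu.2).symm) ?_
  simp only at hu0
  linarith

/-- A constant solution takes the value of a zero of `x ↦ g x - α β x`. -/
lemma zero_of_deriv_eq_zero (S : IsSolution α β g v p q r) (h : ∀ t, p t = 0) (t : ℝ) :
    q t = 0 ∧ r t = 0 ∧ g (v t) = α * β * v t := by
  have dz : ∀ y z : ℝ → ℝ, (∀ t, HasDerivAt y (z t) t) → (∀ t, y t = 0) → ∀ t, z t = 0 := by
    intro y z hy h0 t
    have e : y = fun _ => 0 := funext h0
    have := hy t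
    rw [e] at this
    exact this.unique (hasDerivAt_const t 0)
  have hq := dz _ _ S.deriv_p h
  have hr := dz _ _ S.deriv_q hq
  have := dz _ _ S.deriv_r hr t
  rw [hq t] at this
  exact ⟨hq t, hr t, by linarith⟩

lemma energy_lt_of_const (hg : IsNonlinearity α β g G) (S₁ : IsSolution α β g v₁ p₁ q₁ r₁)
    (S₂ : IsSolution α β g v₂ p₂ q₂ r₂) (h₁ : ∀ t, p₁ t = 0) (h₂ : ∃ t, p₂ t ≠ 0) :
    energy α β G v₁ p₁ q₁ r₁ 0 < energy α β G v₂ p₂ q₂ r₂ 0 := by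
  obtain ⟨a, b, B⟩ := S₂.exists_branch hg h₂
  obtain ⟨t, ht, et⟩ := S₂.exists_zero_of_branch hg B
  obtain ⟨hq, hr, e⟩ := S₁.zero_of_deriv_eq_zero h₁ 0
  rw [S₂.energy_const hg 0 t]
  exact energy_lt hg S₁ S₂ (hg.unique_zero _ _ (S₁.pos _) (S₂.pos _) e et) (h₁ 0).ge
    (by rw [h₁]; exact B.pos t ht) (by rw [hr, h₁, mul_zero]) (by rw [hq]; simpa using sq_nonneg (q₂ t))

/-- Solutions with equal energies are translates of each other. -/
theorem exists_translate (hg : IsNonlinearity α β g G) (S₁ : IsSolution α β g v₁ p₁ q₁ r₁)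
    (S₂ : IsSolution α β g v₂ p₂ q₂ r₂)
    (hE : energy α β G v₁ p₁ q₁ r₁ 0 = energy α β G v₂ p₂ q₂ r₂ 0) :
    ∃ T, ∀ t, v₂ t = v₁ (t + T) := by
  by_cases hmatch : ∃ s t, v₁ s = v₂ t ∧ p₁ s = p₂ t
  · obtain ⟨s, t, hv, hp⟩ := hmatch
    refine ⟨s - t, fun x => ?_⟩
    have := (eq_of_eq hg S₁ S₂ hv hp (x - t)).1
    rw [add_sub_cancel] at this
    rw [← this]
    congr 1
    ring
  exfalso
  push Not at hmatch
  by_cases h₁ : ∃ t, p₁ t ≠ 0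
  · by_cases h₂ : ∃ t, p₂ t ≠ 0
    · obtain ⟨a₁, b₁, B₁⟩ := S₁.exists_branch hg h₁
      obtain ⟨a₂, b₂, B₂⟩ := S₂.exists_branch hg h₂
      rcases lt_or_gt_of_branch S₁ S₂ B₁ B₂ hmatch with h | h
      · exact (energy_lt_of_branch hg S₁ S₂ B₁ B₂ h).ne hE
      · exact (energy_lt_of_branch hg S₂ S₁ B₂ B₁ h).ne' hE
    · push Not at h₂
      exact (energy_lt_of_const hg S₂ S₁ h₂ h₁).ne' hE
  · push Not at h₁
    by_cases h₂ : ∃ t, p₂ t ≠ 0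
    · exact (energy_lt_of_const hg S₁ S₂ h₁ h₂).ne hE
    · push Not at h₂
      refine hmatch 0 0 ?_ (by rw [h₁, h₂])
      exact hg.unique_zero _ _ (S₁.pos _) (S₂.pos _) (S₁.zero_of_deriv_eq_zero h₁ 0).2.2
        (S₂.zero_of_deriv_eq_zero h₂ 0).2.2

end IsSolution

lemma isNonlinearity_rpow {α β C m : ℝ} (hα : 0 < α) (hαβ : α < β) (hC : 0 < C) (hm : 1 < m) :
    IsNonlinearity α β (fun x => C * x ^ m)
      (fun x => -(α * β / 2) * x ^ 2 + C / (m + 1) * x ^ (m + 1)) where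
  pos := hα
  lt := hαβ
  mono x y hx hxy := mul_le_mul_of_nonneg_left
    (Real.rpow_le_rpow hx.le hxy (by linarith)) hC.le
  lipschitz K := by
    refine ⟨C * (m * |K| ^ (m - 1)), by positivity, fun x y hx hxy hyK => ?_⟩
    have hd : ∀ z, HasDerivAt (fun x : ℝ => C * x ^ m) (C * (m * z ^ (m - 1))) z := fun z =>
      (Real.hasDerivAt_rpow_const (Or.inr hm.le)).const_mul C
    refine Convex.image_sub_le_mul_sub_of_deriv_le (convex_Icc x y)
      (fun z _ => (hd z).continuousAt.continuousWithinAt)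
      (fun z _ => (hd z).differentiableAt.differentiableWithinAt) (fun z hz => ?_)
      x ⟨le_rfl, hxy⟩ y ⟨hxy, le_rfl⟩ hxy
    rw [interior_Icc] at hz
    rw [(hd z).deriv]
    have : z ^ (m - 1) ≤ |K| ^ (m - 1) :=
      Real.rpow_le_rpow (hx.trans hz.1).le (hz.2.le.trans (hyK.trans (le_abs_self K)))
        (by linarith)
    gcongr
  unique_zero x y hx hy hx0 hy0 := by
    have aux : ∀ z, 0 < z → C * z ^ m = α * β * z → z ^ (m - 1) = α * β / C := by
      intro z hz h
      rw [Real.rpow_sub_one hz.ne', div_eq_div_iff hz.ne' hC.ne']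
      linarith
    exact Real.rpow_left_injOn (by linarith : m - 1 ≠ 0) hx.le hy.le
      ((aux x hx hx0).trans (aux y hy hy0).symm)
  primitive x hx := by
    have h := ((hasDerivAt_pow 2 x).const_mul (-(α * β / 2))).fun_add
      ((Real.hasDerivAt_rpow_const (x := x) (p := m + 1) (Or.inl hx.ne')).const_mul (C / (m + 1)))
    refine h.congr_deriv ?_
    have : m + 1 ≠ 0 := by linarith
    rw [add_sub_cancel_right]
    field_simp
    push_cast
    ring

lemma hasDerivAt_iteratedDeriv {v : ℝ → ℝ} (hv : ContDiff ℝ 4 v) {k : ℕ} (hk : k < 4) (t : ℝ) :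
    HasDerivAt (iteratedDeriv k v) (iteratedDeriv (k + 1) v t) t := by
  rw [iteratedDeriv_succ]
  exact (hv.differentiable_iteratedDeriv k (by exact_mod_cast hk) t).hasDerivAt

lemma isSolution_of_delaunayODE {n : ℕ} {v : ℝ → ℝ} (hreg : ContDiff ℝ 4 v)
    (hpos : ∀ t, 0 < v t) (hode : ∀ t, DelaunayODE n v t)
    (hper : ∃ T > 0, Function.Periodic v T) :
    IsSolution (((n : ℝ) - 4) ^ 2 / 4) ((n : ℝ) ^ 2 / 4)
      (fun x => (n : ℝ) * ((n : ℝ) - 4) * ((n : ℝ) ^ 2 - 4) / 16 *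
        x ^ (((n : ℝ) + 4) / ((n : ℝ) - 4)))
      v (deriv v) (iteratedDeriv 2 v) (iteratedDeriv 3 v) where
  deriv_v t := by
    simpa using hasDerivAt_iteratedDeriv hreg (k := 0) (by norm_num) t
  deriv_p t := by
    simpa using hasDerivAt_iteratedDeriv hreg (k := 1) (by norm_num) t
  deriv_q t := hasDerivAt_iteratedDeriv hreg (by norm_num) t
  deriv_r t := by
    refine (hasDerivAt_iteratedDeriv hreg (k := 3) (by norm_num) t).congr_deriv ?_
    have := hode t
    unfold DelaunayODE at this
    linear_combination this
  pos := hpos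
  periodic := hper

lemma redHam_eq_energy {n : ℕ} (hn : 5 ≤ n) (v : ℝ → ℝ) (t : ℝ) :
    redHam n v t = energy (((n : ℝ) - 4) ^ 2 / 4) ((n : ℝ) ^ 2 / 4)
      (fun x => -(((n : ℝ) - 4) ^ 2 / 4 * ((n : ℝ) ^ 2 / 4) / 2) * x ^ 2 +
        (n : ℝ) * ((n : ℝ) - 4) * ((n : ℝ) ^ 2 - 4) / 16 /
          (((n : ℝ) + 4) / ((n : ℝ) - 4) + 1) * x ^ (((n : ℝ) + 4) / ((n : ℝ) - 4) + 1))
      v (deriv v) (iteratedDeriv 2 v) (iteratedDeriv 3 v) t := by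
  have hn' : (5 : ℝ) ≤ n := by exact_mod_cast hn
  have h4 : (n : ℝ) - 4 ≠ 0 := by linarith
  have h0 : (n : ℝ) ≠ 0 := by linarith
  have hexp : ((n : ℝ) + 4) / ((n : ℝ) - 4) + 1 = 2 * n / (n - 4) := by
    field_simp
    ring
  have hcoef : (n : ℝ) * ((n : ℝ) - 4) * ((n : ℝ) ^ 2 - 4) / 16 / (2 * n / (n - 4)) =
      ((n : ℝ) - 4) ^ 2 * ((n : ℝ) ^ 2 - 4) / 32 := by
    field_simp
    ring
  simp only [hexp, hcoef, redHam, energy]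
  ring

end Delaunay

/-- van den Berg's energy ordering: two C⁴ positive periodic solutions of the
Delaunay ODE whose (constant) reduced Hamiltonians agree are time translates of each other. -/
theorem delaunay_determined_by_energy (n : ℕ) (hn : 5 ≤ n) (v₁ v₂ : ℝ → ℝ)
    (hreg₁ : ContDiff ℝ 4 v₁) (hpos₁ : ∀ t, 0 < v₁ t) (hode₁ : ∀ t, DelaunayODE n v₁ t)
    (hper₁ : ∃ T > 0, Function.Periodic v₁ T)
    (hreg₂ : ContDiff ℝ 4 v₂) (hpos₂ : ∀ t, 0 < v₂ t) (hode₂ : ∀ t, DelaunayODE n v₂ t)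
    (hper₂ : ∃ T > 0, Function.Periodic v₂ T)
    (hham : redHam n v₁ 0 = redHam n v₂ 0) :
    ∃ T : ℝ, ∀ t : ℝ, v₂ t = v₁ (t + T) := by
  have hn' : (5 : ℝ) ≤ n := by exact_mod_cast hn
  have h4 : 0 < (n : ℝ) - 4 := by linarith
  have hg := Delaunay.isNonlinearity_rpow (α := ((n : ℝ) - 4) ^ 2 / 4) (β := (n : ℝ) ^ 2 / 4)
    (C := (n : ℝ) * ((n : ℝ) - 4) * ((n : ℝ) ^ 2 - 4) / 16)
    (m := ((n : ℝ) + 4) / ((n : ℝ) - 4)) (by positivity) (by nlinarith)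
    (by
      have : 0 < (n : ℝ) ^ 2 - 4 := by nlinarith
      positivity)
    (by rw [lt_div_iff₀ h4]; linarith)
  rw [Delaunay.redHam_eq_energy hn, Delaunay.redHam_eq_energy hn] at hham
  exact Delaunay.IsSolution.exists_translate hg
    (Delaunay.isSolution_of_delaunayODE hreg₁ hpos₁ hode₁ hper₁)
    (Delaunay.isSolution_of_delaunayODE hreg₂ hpos₂ hode₂ hper₂) hham
end

section
/- Let n ≥ 5 be an integer and let v : ℝ → (0,∞) be a C⁴ periodic solution of the Delaunay ODE v''''(t) − ((n(n−4)+8)/2) v''(t) + (n²(n−4)²/16) v(t) = (n(n−4)(n²−4)/16) v(t)^{(n+4)/(n−4)}. Then the constant value of its reduced Hamiltonian is strictly negative: H̄(v) < 0. -/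
/-- At a local minimum the second derivative is nonnegative. -/
lemma IsLocalMin.deriv_deriv_nonneg {f : ℝ → ℝ} {x : ℝ} (h : IsLocalMin f x)
    (hc : ContinuousAt f x) : 0 ≤ deriv (deriv f) x := by
  by_contra! hneg
  have hmax : IsLocalMax f x := isLocalMax_of_deriv_deriv_neg hneg h.deriv_eq_zero hc
  have hconst : f =ᶠ[nhds x] fun _ => f x := by
    filter_upwards [h, hmax] with y h₁ h₂ using le_antisymm h₂ h₁
  have : deriv (deriv f) x = 0 := by
    rw [hconst.deriv.deriv_eq]
    simp
  linarith

/-- A continuous periodic real function attains its minimum. -/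
lemma Function.Periodic.exists_forall_le {f : ℝ → ℝ} {T : ℝ} (hf : Function.Periodic f T)
    (hT : T ≠ 0) (hc : Continuous f) : ∃ s, ∀ t, f s ≤ f t := by
  obtain ⟨m, ⟨s, rfl⟩, hm⟩ :=
    (hf.compact_of_continuous hT hc).exists_isLeast (Set.range_nonempty f)
  exact ⟨s, fun t => hm ⟨t, rfl⟩⟩

lemma Function.Periodic.iteratedDeriv {f : ℝ → ℝ} {T : ℝ} (hf : Function.Periodic f T) (m : ℕ) :
    Function.Periodic (iteratedDeriv m f) T := by
  intro t
  have h := congrFun (iteratedDeriv_comp_add_const m f T) t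
  rw [← h, funext hf]

lemma ContDiff.hasDerivAt_iteratedDeriv {v : ℝ → ℝ} {k m : ℕ} (hv : ContDiff ℝ k v) (hm : m < k)
    (t : ℝ) : HasDerivAt (iteratedDeriv m v) (iteratedDeriv (m + 1) v t) t := by
  rw [iteratedDeriv_succ]
  exact (hv.differentiable_iteratedDeriv m (by exact_mod_cast hm) t).hasDerivAt

/-- The reduced Hamiltonian is constant along positive solutions of the Delaunay ODE. -/
lemma redHam_eq_of_delaunayODE {n : ℕ} (hn : 5 ≤ n) {v : ℝ → ℝ} (hreg : ContDiff ℝ 4 v)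
    (hpos : ∀ t, 0 < v t) (hode : ∀ t, DelaunayODE n v t) (s t : ℝ) :
    redHam n v s = redHam n v t := by
  have hn' : (5 : ℝ) ≤ n := by exact_mod_cast hn
  have hne : (n : ℝ) - 4 ≠ 0 := by linarith
  have hd : ∀ m < 4, ∀ t, HasDerivAt (iteratedDeriv m v) (iteratedDeriv (m + 1) v t) t :=
    fun m hm t => ContDiff.hasDerivAt_iteratedDeriv (k := 4) (by exact_mod_cast hreg) hm t
  have hH : ∀ t, HasDerivAt (redHam n v) 0 t := by
    intro t
    have h0 : HasDerivAt v (deriv v t) t := by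
      simpa [iteratedDeriv_one] using hd 0 (by norm_num) t
    have h1 : HasDerivAt (deriv v) (iteratedDeriv 2 v t) t := by
      simpa [iteratedDeriv_one] using hd 1 (by norm_num) t
    have h2 := hd 2 (by norm_num) t
    have h3 := hd 3 (by norm_num) t
    have hp := h0.rpow_const (p := (2 * (n : ℝ)) / ((n : ℝ) - 4)) (Or.inl (hpos t).ne')
    have hexp : (2 * (n : ℝ)) / ((n : ℝ) - 4) - 1 = ((n : ℝ) + 4) / ((n : ℝ) - 4) := by
      field_simp
      ring
    rw [hexp] at hp
    have hsum := ((((h1.neg.mul h3).add ((h2.pow 2).const_mul (1 / 2))).add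
      ((h1.pow 2).const_mul (((n : ℝ) * ((n : ℝ) - 4) + 8) / 4))).sub
      ((h0.pow 2).const_mul ((n : ℝ) ^ 2 * ((n : ℝ) - 4) ^ 2 / 32))).add
      (hp.const_mul (((n : ℝ) - 4) ^ 2 * ((n : ℝ) ^ 2 - 4) / 32))
    refine hsum.congr_deriv ?_
    have ho := hode t
    unfold DelaunayODE at ho
    have hcoef : ((n : ℝ) - 4) ^ 2 * ((n : ℝ) ^ 2 - 4) / 32 * (2 * (n : ℝ) / ((n : ℝ) - 4))
        = (n : ℝ) * ((n : ℝ) - 4) * ((n : ℝ) ^ 2 - 4) / 16 := by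
      field_simp
      ring
    simp only [Pi.neg_apply]
    norm_num
    linear_combination (-deriv v t) * ho
      + deriv v t * v t ^ (((n : ℝ) + 4) / ((n : ℝ) - 4)) * hcoef
  exact is_const_of_deriv_eq_zero (fun t => (hH t).differentiableAt) (fun t => (hH t).deriv) s t

/-- At a global minimum of a positive periodic solution, the second derivative is controlled by
the maximum principle applied to `((n - 4)² / 4) v - v''`, a supersolution of `n² / 4 - D²`. -/
lemma iteratedDeriv_two_le_of_isMin {n : ℕ} (hn : 5 ≤ n) {v : ℝ → ℝ} (hreg : ContDiff ℝ 4 v)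
    (hpos : ∀ t, 0 < v t) (hode : ∀ t, DelaunayODE n v t) {T : ℝ} (hT : T ≠ 0)
    (hper : Function.Periodic v T) {s : ℝ} (hs : ∀ t, v s ≤ v t) :
    ((n : ℝ) * ((n : ℝ) - 4) * ((n : ℝ) ^ 2 - 4) / 16) * v s ^ (((n : ℝ) + 4) / ((n : ℝ) - 4))
      ≤ (n : ℝ) ^ 2 / 4 * (((n : ℝ) - 4) ^ 2 / 4 * v s - iteratedDeriv 2 v s) := by
  have hn' : (5 : ℝ) ≤ n := by exact_mod_cast hn
  have hd : ∀ m < 4, ∀ t, HasDerivAt (iteratedDeriv m v) (iteratedDeriv (m + 1) v t) t :=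
    fun m hm t => ContDiff.hasDerivAt_iteratedDeriv (k := 4) (by exact_mod_cast hreg) hm t
  set w : ℝ → ℝ := fun t => ((n : ℝ) - 4) ^ 2 / 4 * v t - iteratedDeriv 2 v t with hw
  have hw1 : ∀ t, HasDerivAt w
      (((n : ℝ) - 4) ^ 2 / 4 * iteratedDeriv 1 v t - iteratedDeriv 3 v t) t := fun t => by
    have h0 : HasDerivAt v (iteratedDeriv 1 v t) t := by simpa using hd 0 (by norm_num) t
    exact (h0.const_mul _).sub (hd 2 (by norm_num) t)
  have hw2 : ∀ t, deriv (deriv w) t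
      = ((n : ℝ) - 4) ^ 2 / 4 * iteratedDeriv 2 v t - iteratedDeriv 4 v t := fun t => by
    rw [funext fun t => (hw1 t).deriv]
    exact (((hd 1 (by norm_num) t).const_mul _).sub (hd 3 (by norm_num) t)).deriv
  have hwc : Continuous w := continuous_iff_continuousAt.2 fun t => (hw1 t).continuousAt
  have hwper : Function.Periodic w T := fun t => by
    simp only [hw, hper t, hper.iteratedDeriv 2 t]
  obtain ⟨r, hr⟩ := hwper.exists_forall_le hT hwc
  have hnonneg : 0 ≤ deriv (deriv w) r :=
    IsLocalMin.deriv_deriv_nonneg (Filter.Eventually.of_forall hr) hwc.continuousAt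
  rw [hw2] at hnonneg
  have ho := hode r
  unfold DelaunayODE at ho
  have hpow : v s ^ (((n : ℝ) + 4) / ((n : ℝ) - 4)) ≤ v r ^ (((n : ℝ) + 4) / ((n : ℝ) - 4)) :=
    Real.rpow_le_rpow (hpos s).le (hs r) (div_nonneg (by linarith) (by linarith))
  have hC : 0 ≤ (n : ℝ) * ((n : ℝ) - 4) * ((n : ℝ) ^ 2 - 4) / 16 := by
    have : 0 ≤ (n : ℝ) - 4 := by linarith
    have : 0 ≤ (n : ℝ) ^ 2 - 4 := by nlinarith
    positivity
  have hwr : w r = ((n : ℝ) - 4) ^ 2 / 4 * v r - iteratedDeriv 2 v r := rfl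
  calc _ ≤ _ := mul_le_mul_of_nonneg_left hpow hC
    _ ≤ (n : ℝ) ^ 2 / 4 * w r := by rw [hwr]; linarith
    _ ≤ (n : ℝ) ^ 2 / 4 * w s := mul_le_mul_of_nonneg_left (hr s) (by positivity)

/-- the reduced Hamiltonian of a C⁴ positive periodic solution of the
Delaunay ODE is strictly negative. -/
theorem redHam_neg_of_periodic (n : ℕ) (hn : 5 ≤ n) (v : ℝ → ℝ)
    (hreg : ContDiff ℝ 4 v) (hpos : ∀ t, 0 < v t) (hode : ∀ t, DelaunayODE n v t)
    (hper : ∃ T > 0, Function.Periodic v T) :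
    ∀ t : ℝ, redHam n v t < 0 := by
  obtain ⟨T, hT, hper⟩ := hper
  have hn' : (5 : ℝ) ≤ n := by exact_mod_cast hn
  obtain ⟨s, hs⟩ := hper.exists_forall_le hT.ne' hreg.continuous
  intro t
  rw [redHam_eq_of_delaunayODE hn hreg hpos hode t s]
  have hmin : IsLocalMin v s := Filter.Eventually.of_forall hs
  have hκ : 0 ≤ iteratedDeriv 2 v s := by
    have := hmin.deriv_deriv_nonneg hreg.continuous.continuousAt
    rwa [iteratedDeriv_succ, iteratedDeriv_one]
  have hle := iteratedDeriv_two_le_of_isMin hn hreg hpos hode hT.ne' hper hs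
  have hexp : (2 * (n : ℝ)) / ((n : ℝ) - 4) = ((n : ℝ) + 4) / ((n : ℝ) - 4) + 1 := by
    have : (n : ℝ) - 4 ≠ 0 := by linarith
    field_simp
    ring
  have hX : 0 < v s ^ (((n : ℝ) + 4) / ((n : ℝ) - 4)) := Real.rpow_pos_of_pos (hpos s) _
  unfold redHam
  rw [hmin.deriv_eq_zero, hexp, Real.rpow_add_one (hpos s).ne']
  have hv := hpos s
  generalize iteratedDeriv 2 v s = κ at *
  generalize v s ^ (((n : ℝ) + 4) / ((n : ℝ) - 4)) = X at *
  generalize v s = ε at *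
  obtain ⟨m, hm⟩ : ∃ m : ℝ, (n : ℝ) = m + 4 := ⟨n - 4, by ring⟩
  rw [hm] at hn' hle ⊢
  simp only [add_sub_cancel_right] at hle ⊢
  have hm1 : 1 ≤ m := by linarith
  have hκle : κ ≤ m ^ 2 / 4 * ε := by
    have h0 : 0 ≤ (m + 4) * m * ((m + 4) ^ 2 - 4) / 16 * X := by
      have : 0 ≤ (m + 4) ^ 2 - 4 := by nlinarith
      positivity
    have := (mul_nonneg_iff_of_pos_left (show 0 < (m + 4) ^ 2 / 4 by positivity)).1 (h0.trans hle)
    linarith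
  have hκsq : κ ^ 2 ≤ m ^ 2 / 4 * ε * κ := by nlinarith
  have hbound : m ^ 2 * ((m + 4) ^ 2 - 4) / 32 * (X * ε)
      ≤ m * (m + 4) / 8 * (m ^ 2 / 4 * ε - κ) * ε := by
    have h := mul_le_mul_of_nonneg_left hle (show 0 ≤ m * ε / (2 * (m + 4)) by positivity)
    have e1 : m * ε / (2 * (m + 4)) * ((m + 4) * m * ((m + 4) ^ 2 - 4) / 16 * X)
        = m ^ 2 * ((m + 4) ^ 2 - 4) / 32 * (X * ε) := by
      field_simp
      ring
    have e2 : m * ε / (2 * (m + 4)) * ((m + 4) ^ 2 / 4 * (m ^ 2 / 4 * ε - κ))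
        = m * (m + 4) / 8 * (m ^ 2 / 4 * ε - κ) * ε := by
      field_simp
      ring
    rwa [e1, e2] at h
  have hneg : 0 < (m + 4) * m ^ 2 / 8 * ε ^ 2 := by positivity
  have hmκ : 0 ≤ m * κ * ε := by positivity
  nlinarith
end
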